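/- arXiv:1702.00602 — 2 statements merged into one kernel-verified Lean document; each statement's English description precedes it below -/
import Mathlib

section
/- Suppose that for some $s > 0$ independent of dimension, $(1/2, s)$ is a John–Strömberg pair for $\mathcal{Q}(\mathbb{R}^d)$ for all $d \ge 1$. Then $\left(\frac{2-3s}{4-4s}, \frac{s}{2}\right)$ is a John–Strömberg pair for $\mathcal{Q}(\mathbb{R}^d)$ for all $d \ge 1$, and moreover $\frac{2-3s}{4-4s} < \frac{1}{2}$. -/
open MeasureTheory Set

/-- A closed axis-parallel cube in `ℝ^d` with positive side length. -/
def IsCube {d : ℕ} (Q : Set (Fin d → ℝ)) : Prop :=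
  ∃ (a : Fin d → ℝ) (l : ℝ), 0 < l ∧ Q = Set.univ.pi fun j => Set.Icc (a j) (a j + l)

/-- `(τ, s)` is a John–Strömberg pair for the collection of all cubes in `ℝ^d`. -/
def IsJSPair (d : ℕ) (τ s : ℝ) : Prop :=
  0 < τ ∧ 0 < s ∧
    ∀ Q : Set (Fin d → ℝ), IsCube Q →
      ∀ Ep Em : Set (Fin d → ℝ), MeasurableSet Ep → MeasurableSet Em →
        Ep ⊆ Q → Em ⊆ Q → Disjoint Ep Em →
        min (volume Ep) (volume Em) > ENNReal.ofReal τ * volume ((Q \ Ep) \ Em) →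
        ∃ W : Set (Fin d → ℝ), IsCube W ∧ W ⊆ Q ∧
          min (volume (Ep ∩ W)) (volume (Em ∩ W)) ≥ ENNReal.ofReal s * volume W

/-- A set of density `ρ` on the line which is equidistributed at all scales at least `δ`. -/
lemma exists_equidistributed_set {ρ δ ε : ℝ} (hρ : 0 < ρ) (hρ1 : ρ < 1) (hδ : 0 < δ)
    (hε : 0 < ε) :
    ∃ T : Set ℝ, MeasurableSet T ∧
      ∀ c w : ℝ, δ ≤ w → |volume.real (T ∩ Icc c (c + w)) - ρ * w| ≤ ε * w := by
  set η := ε * δ with hη_def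
  have hη : 0 < η := by positivity
  set T : Set ℝ := {x | 0 < Int.fract (x / η) ∧ Int.fract (x / η) ≤ ρ} with hT_def
  have hT : MeasurableSet T := by
    have hm : Measurable fun x : ℝ => Int.fract (x / η) :=
      measurable_fract.comp (measurable_id.div_const η)
    exact (measurableSet_lt measurable_const hm).inter (measurableSet_le hm measurable_const)
  set f : ℝ → ℝ := T.indicator 1 with hf_def
  have hf0 : ∀ x, 0 ≤ f x := fun x => indicator_nonneg (fun _ _ => zero_le_one) x
  have hf1 : ∀ x, f x ≤ 1 := fun x => indicator_le_self' (fun _ _ => zero_le_one) x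
  have hper : Function.Periodic f η := by
    intro x
    have : x + η ∈ T ↔ x ∈ T := by
      simp only [hT_def, mem_ofPred_eq, add_div, div_self hη.ne', Int.fract_add_one]
    by_cases hx : x ∈ T
    · simp [hf_def, hx, this.2 hx]
    · simp [hf_def, hx, mt this.1 hx]
  have hint : ∀ a b, IntervalIntegrable f volume a b := fun a b =>
    (intervalIntegrable_const (c := (1 : ℝ))).mono_fun
      ((measurable_one.indicator hT).aestronglyMeasurable)
      (Filter.Eventually.of_forall fun x => by
        simpa [abs_of_nonneg (hf0 x)] using hf1 x)
  have hvol : ∀ a b : ℝ, a ≤ b → ∫ x in a..b, f x = volume.real (T ∩ Ioc a b) := by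
    intro a b hab
    rw [intervalIntegral.integral_of_le hab, hf_def, integral_indicator_one hT,
      measureReal_restrict_apply hT]
  have hone : ∫ x in (0 : ℝ)..η, f x = ρ * η := by
    rw [hvol 0 η hη.le]
    have : T ∩ Ioc 0 η = Ioc 0 (ρ * η) := by
      ext x
      simp only [hT_def, mem_inter_iff, mem_ofPred_eq, mem_Ioc]
      constructor
      · rintro ⟨⟨h1, h2⟩, h3, h4⟩
        refine ⟨h3, ?_⟩
        rcases h4.lt_or_eq with h5 | rfl
        · rw [Int.fract_eq_self.2 ⟨by positivity, (div_lt_one hη).2 h5⟩] at h2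
          exact (div_le_iff₀ hη).1 h2
        · simp [div_self hη.ne'] at h1
      · rintro ⟨h3, h4⟩
        have h5 : x < η := h4.trans_lt (by nlinarith)
        rw [Int.fract_eq_self.2 ⟨by positivity, (div_lt_one hη).2 h5⟩]
        exact ⟨⟨by positivity, (div_le_iff₀ hη).2 h4⟩, h3, h5.le⟩
    rw [this, Real.volume_real_Ioc_of_le (by positivity), sub_zero]
  refine ⟨T, hT, fun c w hw => ?_⟩
  have hw0 : 0 < w := hδ.trans_le hw
  set n : ℤ := ⌊w / η⌋
  have hn1 : n * η ≤ w := (le_div_iff₀ hη).1 (Int.floor_le _)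
  have hn2 : w < (n + 1) * η := (div_lt_iff₀ hη).1 (Int.lt_floor_add_one _)
  have hae : volume.real (T ∩ Icc c (c + w)) = ∫ x in c..(c + w), f x := by
    rw [hvol _ _ (by linarith)]
    exact measureReal_congr ((Filter.EventuallyEq.refl _ T).inter Ioc_ae_eq_Icc.symm)
  have hsplit := intervalIntegral.integral_add_adjacent_intervals
    (hint c (c + n • η)) (hint (c + n • η) (c + w))
  rw [hper.intervalIntegral_add_zsmul_eq n c hint, hper.intervalIntegral_add_eq c 0, zero_add,
    hone, zsmul_eq_mul, zsmul_eq_mul] at hsplit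
  have hle : c + n * η ≤ c + w := by linarith
  have hR0 : 0 ≤ ∫ x in (c + n * η)..(c + w), f x :=
    intervalIntegral.integral_nonneg hle fun x _ => hf0 x
  have hR1 : ∫ x in (c + n * η)..(c + w), f x ≤ w - n * η := by
    have := intervalIntegral.integral_mono_on hle (hint _ _)
      (intervalIntegrable_const (c := (1 : ℝ))) fun x _ => hf1 x
    simpa using this
  have hηw : η ≤ ε * w := by rw [hη_def]; gcongr
  rw [hae, ← hsplit, abs_le]
  constructor <;> nlinarith

/-- Separating a coordinate of `ℝ^(d+1)` turns boxes into products. -/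
lemma preimage_piFinSuccAbove_prod {d : ℕ} (b m : ℝ) (a : Fin d → ℝ) :
    MeasurableEquiv.piFinSuccAbove (fun _ : Fin (d + 1) => ℝ) 0 ⁻¹'
      (Icc b (b + m) ×ˢ univ.pi fun j => Icc (a j) (a j + m)) =
    univ.pi fun j => Icc ((Fin.cons b a : Fin (d + 1) → ℝ) j)
      ((Fin.cons b a : Fin (d + 1) → ℝ) j + m) := by
  ext x
  simp only [MeasurableEquiv.piFinSuccAbove, mem_preimage, mem_prod, mem_univ_pi,
    Fin.forall_fin_succ]
  simp [Fin.tail]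

/-- The defining property of a John–Strömberg pair in `ℝ^(d+1)`, read in `ℝ × ℝ^d`. -/
lemma IsJSPair.exists_prod {d : ℕ} {τ s : ℝ} (h : IsJSPair (d + 1) τ s) {a : Fin d → ℝ} {l : ℝ}
    (hl : 0 < l) {Fp Fm : Set (ℝ × (Fin d → ℝ))} (hFp : MeasurableSet Fp)
    (hFm : MeasurableSet Fm)
    (hp : Fp ⊆ Icc 0 l ×ˢ univ.pi fun j => Icc (a j) (a j + l))
    (hm : Fm ⊆ Icc 0 l ×ˢ univ.pi fun j => Icc (a j) (a j + l)) (hd : Disjoint Fp Fm)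
    (hmin : ENNReal.ofReal τ *
      volume (((Icc 0 l ×ˢ univ.pi fun j => Icc (a j) (a j + l)) \ Fp) \ Fm) <
        min (volume Fp) (volume Fm)) :
    ∃ (c w : ℝ) (a' : Fin d → ℝ), 0 < w ∧
      Icc c (c + w) ⊆ Icc 0 l ∧
      (univ.pi fun j => Icc (a' j) (a' j + w)) ⊆ (univ.pi fun j => Icc (a j) (a j + l)) ∧
      ENNReal.ofReal s * volume (Icc c (c + w) ×ˢ univ.pi fun j => Icc (a' j) (a' j + w)) ≤
        min (volume (Fp ∩ Icc c (c + w) ×ˢ univ.pi fun j => Icc (a' j) (a' j + w)))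
          (volume (Fm ∩ Icc c (c + w) ×ˢ univ.pi fun j => Icc (a' j) (a' j + w))) := by
  set e := MeasurableEquiv.piFinSuccAbove (fun _ : Fin (d + 1) => ℝ) 0 with he
  have hvol : ∀ S, volume (e ⁻¹' S) = volume S := fun S =>
    (volume_preserving_piFinSuccAbove (fun _ : Fin (d + 1) => ℝ) 0).measure_preimage_equiv S
  have hbox := preimage_piFinSuccAbove_prod (d := d)
  obtain ⟨W, ⟨b, w, hw, rfl⟩, hWQ, hW⟩ := h.2.2
    (e ⁻¹' (Icc 0 l ×ˢ univ.pi fun j => Icc (a j) (a j + l)))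
    ⟨Fin.cons 0 a, l, hl, by rw [← hbox, zero_add]⟩ (e ⁻¹' Fp) (e ⁻¹' Fm)
    (e.measurable hFp) (e.measurable hFm) (preimage_mono hp) (preimage_mono hm)
    (hd.preimage e) (by rwa [← preimage_sdiff, ← preimage_sdiff, hvol, hvol, hvol])
  obtain ⟨c, a', rfl⟩ : ∃ c a', b = Fin.cons c a' := ⟨b 0, Fin.tail b, (Fin.cons_self_tail b).symm⟩
  rw [← hbox] at hWQ hW
  rw [e.surjective.preimage_subset_preimage_iff] at hWQ
  rw [← he, ← preimage_inter, ← preimage_inter, hvol, hvol, hvol] at hW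
  have hne : (Icc c (c + w) ×ˢ univ.pi fun j => Icc (a' j) (a' j + w)).Nonempty :=
    ⟨(c, a'), ⟨le_rfl, by linarith⟩, fun j _ => ⟨le_rfl, by linarith⟩⟩
  obtain ⟨h1, h2⟩ := (prod_subset_prod_iff.1 hWQ).resolve_right fun h => by
    rcases h with h | h
    · exact (hne.fst).ne_empty h
    · exact (hne.snd).ne_empty h
  exact ⟨c, w, a', hw, h1, h2, hW⟩

/-- The second entry of a John–Strömberg pair in `ℝ` is at most `1 / 2`. -/
lemma IsJSPair.le_half {τ s : ℝ} (h : IsJSPair 1 τ s) : s ≤ 1 / 2 := by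
  set Q : Set (Fin 1 → ℝ) := univ.pi fun _ => Icc 0 1 with hQ
  set H : Set (Fin 1 → ℝ) := {x | x 0 < 1 / 2}
  have hHm : MeasurableSet H := measurableSet_lt (measurable_pi_apply 0) measurable_const
  have hQm : MeasurableSet Q := MeasurableSet.univ_pi fun _ => measurableSet_Icc
  have hpos : ∀ b c : ℝ, b < c → 0 < volume (univ.pi fun _ : Fin 1 => Ioo b c) := by
    intro b c hbc
    simp [Real.volume_pi_Ioo, hbc]
  obtain ⟨W, ⟨a, l, hl, rfl⟩, -, hW⟩ := h.2.2 Q ⟨0, 1, one_pos, by simp [hQ]⟩ (Q ∩ H) (Q \ H)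
    (hQm.inter hHm) (hQm.diff hHm) inter_subset_left sdiff_subset
    (disjoint_sdiff_inter.symm) (by
      have : (Q \ (Q ∩ H)) \ (Q \ H) = ∅ := by
        ext x; simp only [mem_sdiff, mem_inter_iff, mem_empty_iff_false]; tauto
      rw [this, measure_empty, mul_zero, gt_iff_lt, lt_min_iff]
      constructor
      · refine (hpos 0 (1 / 2) (by norm_num)).trans_le (measure_mono fun x hx => ?_)
        have := hx 0 trivial
        refine ⟨fun i _ => ?_, this.2⟩
        rw [Subsingleton.elim i 0]
        exact ⟨this.1.le, by linarith [this.2]⟩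
      · refine (hpos (1 / 2) 1 (by norm_num)).trans_le (measure_mono fun x hx => ?_)
        have := hx 0 trivial
        refine ⟨fun i _ => ?_, fun hh => lt_asymm hh this.1⟩
        rw [Subsingleton.elim i 0]
        exact ⟨by linarith [this.1], this.2.le⟩)
  set W : Set (Fin 1 → ℝ) := univ.pi fun j => Icc (a j) (a j + l) with hWdef
  have hWvol : volume W = ENNReal.ofReal l := by
    rw [hWdef, volume_pi_pi]
    simp
  have hsum : volume (Q ∩ H ∩ W) + volume (Q \ H ∩ W) ≤ volume W := by
    rw [← measure_union (disjoint_sdiff_inter.symm.mono inter_subset_left inter_subset_left)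
      ((hQm.diff hHm).inter (MeasurableSet.univ_pi fun _ => measurableSet_Icc))]
    exact measure_mono (union_subset inter_subset_right inter_subset_right)
  have h2 := (add_le_add (le_min_iff.1 hW).1 (le_min_iff.1 hW).2).trans hsum
  have hs := h.2.1
  rw [hWvol, ← ENNReal.ofReal_mul hs.le, ← ENNReal.ofReal_add (by positivity) (by positivity),
    ENNReal.ofReal_le_ofReal_iff hl.le] at h2
  nlinarith

/-- Disjoint compact sets can only both be met by cubes whose side length is bounded below. -/
lemma exists_pos_le_side_of_isCompact {d : ℕ} {A K : Set (Fin d → ℝ)} (hA : IsCompact A)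
    (hK : IsCompact K) (hAK : Disjoint A K) :
    ∃ δ > 0, ∀ (a : Fin d → ℝ) (w : ℝ), 0 ≤ w →
      (A ∩ univ.pi fun j => Icc (a j) (a j + w)).Nonempty →
      (K ∩ univ.pi fun j => Icc (a j) (a j + w)).Nonempty → δ ≤ w := by
  obtain ⟨r, hr, h⟩ := Metric.exists_pos_forall_lt_edist hA hK.isClosed hAK
  refine ⟨r, by exact_mod_cast hr, ?_⟩
  rintro a w hw ⟨x, hxA, hx⟩ ⟨y, hyK, hy⟩
  have h1 := h x hxA y hyK
  rw [edist_nndist, ENNReal.coe_lt_coe, ← NNReal.coe_lt_coe, coe_nndist] at h1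
  refine h1.le.trans ((dist_pi_le_iff hw).2 fun j => ?_)
  have h2 := hx j trivial
  have h3 := hy j trivial
  rw [Real.dist_eq, abs_le]
  constructor <;> linarith [h2.1, h2.2, h3.1, h3.2]

/-- A measurable set of finite measure is approximated in measure by a compact subset. -/
lemma exists_isCompact_subset_measureReal {d : ℕ} {A : Set (Fin d → ℝ)} (hA : MeasurableSet A)
    (hfin : volume A ≠ ⊤) {ε : ℝ} (hε : 0 < ε) :
    ∃ K ⊆ A, IsCompact K ∧ volume.real A - ε ≤ volume.real K := by
  obtain ⟨K, hKA, hK, h⟩ := hA.exists_isCompact_sdiff_lt hfin (ENNReal.ofReal_pos.2 hε).ne'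
  refine ⟨K, hKA, hK, ?_⟩
  have h1 : volume.real (A \ K) < ε := by
    rw [measureReal_def]
    exact (ENNReal.lt_ofReal_iff_toReal_lt (ne_top_of_lt h)).1 h
  rw [measureReal_sdiff hKA hK.measurableSet hfin] at h1
  linarith

lemma ofReal_mul_measure_lt_iff {α β : Type*} [MeasurableSpace α] [MeasurableSpace β]
    {μ : Measure α} {ν : Measure β} {c : ℝ} (hc : 0 ≤ c) {X : Set α} {Y : Set β} (hX : μ X ≠ ⊤)
    (hY : ν Y ≠ ⊤) : ENNReal.ofReal c * μ X < ν Y ↔ c * μ.real X < ν.real Y := by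
  rw [← ofReal_measureReal hX, ← ofReal_measureReal hY, ← ENNReal.ofReal_mul hc,
    ENNReal.ofReal_lt_ofReal_iff_of_nonneg (mul_nonneg hc measureReal_nonneg)]

lemma ofReal_mul_measure_le_iff {α β : Type*} [MeasurableSpace α] [MeasurableSpace β]
    {μ : Measure α} {ν : Measure β} {c : ℝ} (hc : 0 ≤ c) {X : Set α} {Y : Set β} (hX : μ X ≠ ⊤)
    (hY : ν Y ≠ ⊤) : ENNReal.ofReal c * μ X ≤ ν Y ↔ c * μ.real X ≤ ν.real Y := by
  rw [← ofReal_measureReal hX, ← ofReal_measureReal hY, ← ENNReal.ofReal_mul hc,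
    ENNReal.ofReal_le_ofReal_iff measureReal_nonneg]

/-- A John–Strömberg pair `(1 / 2, s)` in `ℝ^(d+1)` gives a better pair in `ℝ^d`: thicken the sets
by an interval, and enlarge one of them by a finely spread portion of the remaining set. -/
lemma IsJSPair.improve {d : ℕ} {s : ℝ} (hs2 : s ≤ 1 / 2) (h : IsJSPair (d + 1) (1 / 2) s) :
    IsJSPair d ((2 - 3 * s) / (4 - 4 * s)) (s / 2) := by
  have hs := h.2.1
  obtain ⟨θ, hθ, hθ0, hθ1⟩ : ∃ θ : ℝ, θ * (1 - s) = s / 2 ∧ 0 < θ ∧ θ < 1 := by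
    refine ⟨s / (2 * (1 - s)), by field_simp [(by linarith : 1 - s ≠ 0)], ?_, ?_⟩
    · exact div_pos hs (by linarith)
    · rw [div_lt_one (by linarith)]; linarith
  have hτ : (2 - 3 * s) / (4 - 4 * s) = (1 - θ) / 2 := by
    rw [div_eq_div_iff (by linarith) two_ne_zero]
    linarith
  rw [hτ]
  refine ⟨by linarith, by linarith, ?_⟩
  rintro Q ⟨a, l, hl, rfl⟩ Ep Em hEp hEm hEpQ hEmQ hdisj hmin
  set Q : Set (Fin d → ℝ) := univ.pi fun j => Icc (a j) (a j + l) with hQ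
  have hcube : ∀ (b : Fin d → ℝ) (m : ℝ),
      volume (univ.pi fun j => Icc (b j) (b j + m)) ≠ ⊤ := fun b m =>
    (isCompact_univ_pi fun j => isCompact_Icc).measure_ne_top
  have hcubem : ∀ (b : Fin d → ℝ) (m : ℝ),
      MeasurableSet (univ.pi fun j => Icc (b j) (b j + m)) := fun b m =>
    MeasurableSet.univ_pi fun j => measurableSet_Icc
  have hfin : ∀ {S}, S ⊆ Q → volume S ≠ ⊤ := fun hS =>
    ne_top_of_le_ne_top (hcube a l) (measure_mono hS)
  set G := (Q \ Ep) \ Em with hG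
  have hGQ : G ⊆ Q := sdiff_subset.trans sdiff_subset
  have hGm : MeasurableSet G := ((hcubem a l).diff hEp).diff hEm
  rw [gt_iff_lt, lt_min_iff, ofReal_mul_measure_lt_iff (by linarith) (hfin hGQ) (hfin hEpQ),
    ofReal_mul_measure_lt_iff (by linarith) (hfin hGQ) (hfin hEmQ)] at hmin
  obtain ⟨hminp, hminm⟩ := hmin
  have hGvol : volume.real G = volume.real Q - volume.real Ep - volume.real Em := by
    rw [hG, measureReal_sdiff (subset_sdiff.2 ⟨hEmQ, hdisj.symm⟩) hEm
      (hfin sdiff_subset), measureReal_sdiff hEpQ hEp (hcube a l)]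
  obtain ⟨ε, hε, hεp, hεm⟩ : ∃ ε > 0, (1 - θ) / 2 * volume.real G + 4 * ε ≤ volume.real Ep ∧
      (1 - θ) / 2 * volume.real G + 4 * ε ≤ volume.real Em := by
    obtain ⟨m, hm, hm'⟩ := exists_between (lt_min hminp hminm)
    obtain ⟨hmp, hmm⟩ := lt_min_iff.1 hm'
    exact ⟨(m - (1 - θ) / 2 * volume.real G) / 4, by linarith, by linarith, by linarith⟩
  have hG0 : 0 ≤ volume.real G := measureReal_nonneg
  obtain ⟨κ, hκ, hκθ, hκG⟩ : ∃ κ > 0, 2 * κ ≤ θ ∧ κ * volume.real G ≤ ε := by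
    refine ⟨min (θ / 2) (ε / (volume.real G + 1)), by positivity, ?_, ?_⟩
    · linarith [min_le_left (θ / 2) (ε / (volume.real G + 1))]
    · calc _ ≤ ε / (volume.real G + 1) * (volume.real G + 1) := by
            gcongr
            · exact min_le_right _ _
            · linarith
        _ = ε := by field_simp
  obtain ⟨A, hAG, hA, hAvol⟩ := exists_isCompact_subset_measureReal hGm (hfin hGQ) hε
  obtain ⟨K, hKEm, hK, hKvol⟩ := exists_isCompact_subset_measureReal hEm (hfin hEmQ) hε
  have hAQ := hAG.trans hGQ
  have hKQ := hKEm.trans hEmQ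
  have hAK : Disjoint A K := (disjoint_sdiff_left : Disjoint G Em).mono hAG hKEm
  have hAEp : Disjoint A Ep :=
    (disjoint_sdiff_left : Disjoint (Q \ Ep) Ep).mono (hAG.trans sdiff_subset) le_rfl
  have hEpK : Disjoint Ep K := hdisj.mono le_rfl hKEm
  obtain ⟨δ, hδ, hsep⟩ := exists_pos_le_side_of_isCompact hA hK hAK
  obtain ⟨T, hT, hTvol⟩ := exists_equidistributed_set (ρ := θ - κ) (δ := min δ l) (ε := κ)
    (by linarith) (by linarith) (lt_min hδ hl) hκ
  have hTl := abs_le.1 (hTvol 0 l (min_le_right _ _))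
  rw [zero_add] at hTl
  set Fp : Set (ℝ × (Fin d → ℝ)) := Icc 0 l ×ˢ Ep ∪ (T ∩ Icc 0 l) ×ˢ A with hFp
  set Fm : Set (ℝ × (Fin d → ℝ)) := Icc 0 l ×ˢ K with hFm
  have hFpm : MeasurableSet Fp := (measurableSet_Icc.prod hEp).union
    ((hT.inter measurableSet_Icc).prod hA.measurableSet)
  have hFmm : MeasurableSet Fm := measurableSet_Icc.prod hK.measurableSet
  have hFpQ : Fp ⊆ Icc 0 l ×ˢ Q := union_subset (prod_mono le_rfl hEpQ)
    (prod_mono inter_subset_right hAQ)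
  have hFmQ : Fm ⊆ Icc 0 l ×ˢ Q := prod_mono le_rfl hKQ
  have hFd : Disjoint Fp Fm := disjoint_union_left.2
    ⟨disjoint_prod.2 (Or.inr hEpK), disjoint_prod.2 (Or.inr hAK)⟩
  have hbox : ∀ (c w : ℝ) (b : Fin d → ℝ) (m : ℝ),
      volume (Icc c w ×ˢ univ.pi fun j => Icc (b j) (b j + m)) ≠ ⊤ := fun c w b m =>
    (isCompact_Icc.prod (isCompact_univ_pi fun j => isCompact_Icc)).measure_ne_top
  have hfin' : ∀ {S}, S ⊆ Icc 0 l ×ˢ Q → volume S ≠ ⊤ := fun hS =>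
    ne_top_of_le_ne_top (hbox 0 l a l) (measure_mono hS)
  have hprod : ∀ (I : Set ℝ) (S : Set (Fin d → ℝ)),
      volume.real (I ×ˢ S) = volume.real I * volume.real S := fun I S =>
    measureReal_prod_prod I S
  have hIl : volume.real (Icc 0 l) = l := by simp [hl.le]
  have hFpvol : volume.real Fp =
      l * volume.real Ep + volume.real (T ∩ Icc 0 l) * volume.real A := by
    rw [hFp, measureReal_union (disjoint_prod.2 (Or.inr hAEp.symm))
      ((hT.inter measurableSet_Icc).prod hA.measurableSet)
      (hfin' (subset_union_left.trans hFpQ)) (hfin' (subset_union_right.trans hFpQ)),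
      hprod, hprod, hIl]
  have hFmvol : volume.real Fm = l * volume.real K := by rw [hFm, hprod, hIl]
  have hrest : volume.real ((Icc 0 l ×ˢ Q \ Fp) \ Fm) =
      l * volume.real Q - volume.real Fp - volume.real Fm := by
    rw [measureReal_sdiff (subset_sdiff.2 ⟨hFmQ, hFd.symm⟩) hFmm (hfin' sdiff_subset),
      measureReal_sdiff hFpQ hFpm (hbox 0 l a l), hprod, hIl]
  have hA0 : 0 ≤ volume.real A := measureReal_nonneg
  have hAle : volume.real A ≤ volume.real G := measureReal_mono hAG (hfin hGQ)
  have htA : l * (θ * volume.real G - 3 * ε) ≤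
      volume.real (T ∩ Icc 0 l) * volume.real A := by
    calc l * (θ * volume.real G - 3 * ε) ≤ l * ((θ - 2 * κ) * volume.real A) := by
          gcongr
          have h1 := mul_nonneg (sub_nonneg.2 hκθ) (sub_nonneg.2 hAvol)
          have h2 : θ * ε ≤ 1 * ε := by gcongr
          linarith [mul_pos hκ hε]
      _ = (θ - 2 * κ) * l * volume.real A := by ring
      _ ≤ _ := by
          gcongr
          linarith [hTl.1]
  have htA0 : 0 ≤ volume.real (T ∩ Icc 0 l) * volume.real A := by positivity
  obtain ⟨c, w, b, hw, hI, hWQ, hW⟩ := h.exists_prod hl hFpm hFmm hFpQ hFmQ hFd (by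
    rw [lt_min_iff, ofReal_mul_measure_lt_iff (by norm_num) (hfin' (sdiff_subset.trans sdiff_subset))
      (hfin' hFpQ), ofReal_mul_measure_lt_iff (by norm_num)
      (hfin' (sdiff_subset.trans sdiff_subset)) (hfin' hFmQ), hrest, hFpvol, hFmvol]
    have h1 := mul_le_mul_of_nonneg_left hεp hl.le
    have h2 := mul_le_mul_of_nonneg_left hεm hl.le
    have h3 := mul_le_mul_of_nonneg_left hKvol hl.le
    have h4 : 0 < l * ε := by positivity
    have h5 : l * volume.real Q = l * volume.real G + l * volume.real Ep + l * volume.real Em := by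
      rw [hGvol]; ring
    constructor <;> linarith)
  set W : Set (Fin d → ℝ) := univ.pi fun j => Icc (b j) (b j + w) with hWdef
  have hWfin : volume W ≠ ⊤ := hcube b w
  have hfinW : ∀ {S : Set (Fin d → ℝ)}, volume (S ∩ W) ≠ ⊤ :=
    ne_top_of_le_ne_top hWfin (measure_mono inter_subset_right)
  have hfinJW : ∀ {S : Set (ℝ × (Fin d → ℝ))}, volume (S ∩ Icc c (c + w) ×ˢ W) ≠ ⊤ :=
    ne_top_of_le_ne_top (hbox c (c + w) b w) (measure_mono inter_subset_right)
  have hJ : volume.real (Icc c (c + w)) = w := by simp [hw.le]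
  rw [le_min_iff, ofReal_mul_measure_le_iff hs.le (hbox c (c + w) b w) hfinJW,
    ofReal_mul_measure_le_iff hs.le (hbox c (c + w) b w) hfinJW, hprod, hJ] at hW
  obtain ⟨hWp, hWm⟩ := hW
  have hFpW : volume.real (Fp ∩ Icc c (c + w) ×ˢ W) ≤
      w * volume.real (Ep ∩ W) + volume.real (T ∩ Icc c (c + w)) * volume.real (A ∩ W) := by
    rw [hFp, union_inter_distrib_right, prod_inter_prod, prod_inter_prod, inter_assoc,
      inter_eq_right.2 hI]
    refine (measureReal_union_le _ _).trans_eq ?_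
    rw [hprod, hprod, hJ]
  rw [hFm, prod_inter_prod, inter_eq_right.2 hI, hprod, hJ] at hWm
  have hK' : s * volume.real W ≤ volume.real (K ∩ W) := by
    refine le_of_mul_le_mul_left ?_ hw
    linarith
  have hKEm' : volume.real (K ∩ W) ≤ volume.real (Em ∩ W) :=
    measureReal_mono (inter_subset_inter_left _ hKEm) hfinW
  have hW0 : 0 ≤ volume.real W := measureReal_nonneg
  have hEp0 : 0 ≤ volume.real (Ep ∩ W) := measureReal_nonneg
  have hAKW : volume.real (A ∩ W) + volume.real (K ∩ W) ≤ volume.real W := by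
    rw [← measureReal_union (hAK.mono inter_subset_left inter_subset_left)
      (hK.measurableSet.inter (hcubem b w)) hfinW hfinW]
    exact measureReal_mono (union_subset inter_subset_right inter_subset_right) hWfin
  refine ⟨W, ⟨b, w, hw, rfl⟩, hWQ, ?_⟩
  rw [ge_iff_le, le_min_iff, ofReal_mul_measure_le_iff (by linarith) hWfin hfinW,
    ofReal_mul_measure_le_iff (by linarith) hWfin hfinW]
  refine ⟨?_, by linarith [mul_nonneg hs.le hW0]⟩
  rcases (A ∩ W).eq_empty_or_nonempty with hAe | hAne
  · rw [hAe, measureReal_empty, mul_zero, add_zero] at hFpW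
    refine le_of_mul_le_mul_left ?_ hw
    linarith [mul_nonneg hw.le (mul_nonneg hs.le hW0)]
  rcases (K ∩ W).eq_empty_or_nonempty with hKe | hKne
  · rw [hKe, measureReal_empty] at hK'
    linarith
  have hTw := (abs_le.1 (hTvol c w ((min_le_left _ _).trans (hsep b w hw.le hAne hKne)))).2
  refine le_of_mul_le_mul_left ?_ hw
  have h1 : volume.real (T ∩ Icc c (c + w)) * volume.real (A ∩ W) ≤
      θ * w * ((1 - s) * volume.real W) := by
    gcongr
    · linarith
    · linarith
  have h2 : θ * w * ((1 - s) * volume.real W) = w * (s / 2 * volume.real W) := by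
    rw [← hθ]; ring
  linarith

theorem stmt_6 (s : ℝ) (hs : 0 < s)
    (h : ∀ d : ℕ, 1 ≤ d → IsJSPair d (1 / 2) s) :
    (∀ d : ℕ, 1 ≤ d → IsJSPair d ((2 - 3 * s) / (4 - 4 * s)) (s / 2)) ∧
      (2 - 3 * s) / (4 - 4 * s) < 1 / 2 := by
  have hs2 : s ≤ 1 / 2 := (h 1 le_rfl).le_half
  refine ⟨fun d _ => (h (d + 1) (Nat.le_add_left 1 d)).improve hs2, ?_⟩
  rw [div_lt_div_iff₀ (by linarith) two_pos]
  linarith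
end

section
/- Let $d \ge 1$ and let $(\tau, s)$ be a pair of positive reals. Then $(\tau, s)$ is a John–Strömberg pair for $\mathcal{Q}(\mathbb{R}^d)$ if and only if: whenever $F_+$ and $F_-$ are disjoint $d$-multi-cubes with $\min\{\lambda(F_+), \lambda(F_-)\} \ge \tau \lambda([0,1]^d \setminus F_+ \setminus F_-)$ (non-strict inequality), there exists a cube $W \subseteq [0,1]^d$ with $\min\{\lambda(W \cap F_+), \lambda(W \cap F_-)\} \ge s \lambda(W)$. -/
open MeasureTheory Set

/-- A dyadic subcube of `[0,1]^d`: `∏_j [(n_j - 1) 2^{-k}, n_j 2^{-k}]` with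
`k ∈ ℕ` and `1 ≤ n_j ≤ 2^k`. -/
def IsDyadicSubcube {d : ℕ} (Q : Set (Fin d → ℝ)) : Prop :=
  ∃ (k : ℕ) (n : Fin d → ℕ), (∀ j, 1 ≤ n j ∧ n j ≤ 2 ^ k) ∧
    Q = Set.univ.pi fun j => Set.Icc (((n j : ℝ) - 1) / 2 ^ k) ((n j : ℝ) / 2 ^ k)

/-- A `d`-multi-cube: a non-empty finite union of dyadic subcubes of `[0,1]^d`. -/
def IsMultiCube {d : ℕ} (F : Set (Fin d → ℝ)) : Prop :=
  ∃ C : Set (Set (Fin d → ℝ)), C.Finite ∧ C.Nonempty ∧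
    (∀ Q ∈ C, IsDyadicSubcube Q) ∧ F = ⋃₀ C

open Metric Filter Topology
open scoped ENNReal

theorem closedBall_eq_pi_Icc {d : ℕ} (x : Fin d → ℝ) {r : ℝ} (hr : 0 ≤ r) :
    closedBall x r = Set.univ.pi fun j => Icc (x j - r) (x j + r) := by
  simp only [closedBall_pi x hr, Real.closedBall_eq_Icc]

theorem isCube_iff_closedBall {d : ℕ} {Q : Set (Fin d → ℝ)} :
    IsCube Q ↔ ∃ (x : Fin d → ℝ) (r : ℝ), 0 < r ∧ Q = closedBall x r := by
  constructor
  · rintro ⟨a, l, hl, rfl⟩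
    refine ⟨fun j => a j + l / 2, l / 2, by positivity, ?_⟩
    rw [closedBall_eq_pi_Icc _ (by positivity)]
    congr! 3 <;> ring
  · rintro ⟨x, r, hr, rfl⟩
    refine ⟨fun j => x j - r, 2 * r, by positivity, ?_⟩
    rw [closedBall_eq_pi_Icc _ hr.le]
    congr! 3
    ring

theorem unitCube_eq_closedBall (d : ℕ) :
    (Set.univ.pi fun _ : Fin d => Icc (0 : ℝ) 1) = closedBall (fun _ => 1 / 2) (1 / 2) := by
  rw [closedBall_eq_pi_Icc _ (by norm_num)]
  norm_num

theorem tendsto_volume_closedBall_inter_cthickening {d : ℕ} {K : Set (Fin d → ℝ)}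
    (hK : IsClosed K) (x : Fin d → ℝ) (r : ℝ) :
    Tendsto (fun η => volume (closedBall x (r + η) ∩ cthickening η K)) (𝓝[>] 0)
      (𝓝 (volume (closedBall x r ∩ K))) := by
  have hinter : (⋂ η > (0 : ℝ), closedBall x (r + η) ∩ cthickening η K) = closedBall x r ∩ K := by
    ext y
    have hy : y ∈ K ↔ ∀ η : ℝ, 0 < η → y ∈ cthickening η K := by
      conv_lhs => rw [← hK.closure_eq, closure_eq_iInter_cthickening]
      simp
    simp only [mem_iInter, mem_inter_iff, mem_closedBall, hy]
    constructor
    · intro h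
      exact ⟨le_of_forall_pos_le_add fun η hη => (h η hη).1, fun η hη => (h η hη).2⟩
    · rintro ⟨h₁, h₂⟩ η hη
      exact ⟨h₁.trans (by linarith [show 0 < η from hη]), h₂ η hη⟩
  rw [← hinter]
  refine tendsto_measure_biInter_gt
    (s := fun η => closedBall x (r + η) ∩ cthickening η K)
    (fun η _ => (isClosed_closedBall.inter isClosed_cthickening).nullMeasurableSet) ?_ ?_
  · intro i j _ hij
    exact inter_subset_inter (closedBall_subset_closedBall (by linarith)) (cthickening_mono hij K)
  · exact ⟨1, one_pos, ((measure_mono inter_subset_left).trans_lt measure_closedBall_lt_top).ne⟩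

theorem tendsto_volume_closedBall {d : ℕ} {ι : Type*} {f : Filter ι}
    {X : ι → Fin d → ℝ} {ρ : ι → ℝ} (hρ : ∀ i, 0 < ρ i) {x : Fin d → ℝ} {r : ℝ} (hr : 0 < r)
    (hlim : Tendsto ρ f (𝓝 r)) :
    Tendsto (fun i => volume (closedBall (X i) (ρ i))) f (𝓝 (volume (closedBall x r))) := by
  simp_rw [Real.volume_pi_closedBall _ (hρ _).le, Real.volume_pi_closedBall _ hr.le]
  exact ENNReal.tendsto_ofReal ((hlim.const_mul 2).pow _)

theorem const_mul_volume_closedBall_le_of_tendsto {d : ℕ} {K : Set (Fin d → ℝ)} (hK : IsClosed K)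
    {σ : ℝ≥0∞} (hσ : σ ≠ ∞) {X : ℕ → Fin d → ℝ} {ρ ε : ℕ → ℝ} (hρ : ∀ n, 0 < ρ n)
    {x : Fin d → ℝ} {r : ℝ} (hr : 0 < r) (hX : Tendsto X atTop (𝓝 x))
    (hρr : Tendsto ρ atTop (𝓝 r)) (hε : Tendsto ε atTop (𝓝 0))
    (h : ∀ n, σ * volume (closedBall (X n) (ρ n)) ≤
      volume (closedBall (X n) (ρ n) ∩ cthickening (ε n) K)) :
    σ * volume (closedBall x r) ≤ volume (closedBall x r ∩ K) := by
  refine ge_of_tendsto (tendsto_volume_closedBall_inter_cthickening hK x r) ?_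
  filter_upwards [self_mem_nhdsWithin] with η (hη : 0 < η)
  refine le_of_tendsto (ENNReal.Tendsto.const_mul
    (tendsto_volume_closedBall (X := X) hρ hr hρr) (Or.inr hσ)) ?_
  filter_upwards [hε.eventually (gt_mem_nhds hη),
    hX.eventually (ball_mem_nhds x (half_pos hη)),
    hρr.eventually (gt_mem_nhds (show r < r + η / 2 by linarith))] with n h₁ h₂ h₃
  refine (h n).trans (measure_mono (inter_subset_inter ?_ (cthickening_mono h₁.le K)))
  refine closedBall_subset_closedBall' ?_
  have : dist (X n) x < η / 2 := h₂
  linarith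

theorem closedBall_subset_of_tendsto {E : Type*} [NormedAddCommGroup E] [NormedSpace ℝ E]
    {C : Set E} (hC : IsClosed C) {X : ℕ → E} {ρ : ℕ → ℝ} (hρ : ∀ n, 0 < ρ n) {x : E} {r : ℝ}
    (hr : 0 < r) (hX : Tendsto X atTop (𝓝 x)) (hρr : Tendsto ρ atTop (𝓝 r))
    (h : ∀ n, closedBall (X n) (ρ n) ⊆ C) : closedBall x r ⊆ C := by
  intro y hy
  have hlim : Tendsto (fun n => X n + (ρ n / r) • (y - x)) atTop (𝓝 (x + (r / r) • (y - x))) :=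
    hX.add ((hρr.div_const r).smul_const _)
  rw [div_self hr.ne', one_smul, add_sub_cancel] at hlim
  refine hC.mem_of_tendsto hlim (Eventually.of_forall fun n => h n ?_)
  rw [mem_closedBall, dist_eq_norm, add_sub_cancel_left, norm_smul, Real.norm_eq_abs,
    abs_of_pos (div_pos (hρ n) hr), div_mul_eq_mul_div, div_le_iff₀ hr]
  exact mul_le_mul_of_nonneg_left (by simpa [dist_eq_norm] using hy) (hρ n).le

theorem radius_le_diam_of_closedBall_subset {d : ℕ} (hd : 1 ≤ d) {C : Set (Fin d → ℝ)}
    (hC : Bornology.IsBounded C) {x : Fin d → ℝ} {r : ℝ} (hr : 0 < r) (h : closedBall x r ⊆ C) :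
    r ≤ diam C := by
  have : Nonempty (Fin d) := ⟨⟨0, hd⟩⟩
  have hdist : dist (x + fun _ => r) x = r := by
    rw [dist_eq_norm, add_sub_cancel_left, pi_norm_const, Real.norm_eq_abs, abs_of_pos hr]
  calc r = dist (x + fun _ => r) x := hdist.symm
    _ ≤ diam C := dist_le_diam_of_mem hC (h (by rw [mem_closedBall, hdist]))
      (h (mem_closedBall_self hr.le))

theorem div_four_le_radius_of_inter_cthickening {α : Type*} [PseudoMetricSpace α] {K L : Set α}
    {δ ε r : ℝ} {x : α} (hε : 0 ≤ ε) (hεδ : ε ≤ δ / 2) (hr : 0 < r)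
    (hdisj : Disjoint (cthickening δ K) (cthickening δ L))
    (hK : (closedBall x r ∩ cthickening ε K).Nonempty)
    (hL : (closedBall x r ∩ cthickening ε L).Nonempty) : δ / 4 ≤ r := by
  obtain ⟨y, hyx, hyK⟩ := hK
  obtain ⟨z, hzx, hzL⟩ := hL
  by_contra! hlt
  have hzy : dist z y ≤ δ / 2 := by
    have := dist_triangle_right z y x
    simp only [mem_closedBall] at hyx hzx
    linarith
  have hz : z ∈ cthickening δ K := by
    have : z ∈ cthickening (δ / 2) (cthickening ε K) := mem_cthickening_of_dist_le z y _ _ hyK hzy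
    exact cthickening_mono (by linarith) K
      (cthickening_cthickening_subset (by linarith) hε K this)
  exact disjoint_left.1 hdisj hz (cthickening_mono (by linarith) L hzL)

theorem exists_closedBall_of_cthickening {d : ℕ} (hd : 1 ≤ d) {C K L : Set (Fin d → ℝ)}
    (hC : IsCompact C) (hK : IsCompact K) (hL : IsCompact L) (hKL : Disjoint K L)
    {σ : ℝ≥0∞} (hσ₀ : σ ≠ 0) (hσ : σ ≠ ∞)
    (h : ∀ᶠ ε in 𝓝[>] (0 : ℝ), ∃ (x : Fin d → ℝ) (r : ℝ), 0 < r ∧ closedBall x r ⊆ C ∧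
      σ * volume (closedBall x r) ≤ volume (closedBall x r ∩ cthickening ε K) ∧
      σ * volume (closedBall x r) ≤ volume (closedBall x r ∩ cthickening ε L)) :
    ∃ (x : Fin d → ℝ) (r : ℝ), 0 < r ∧ closedBall x r ⊆ C ∧
      σ * volume (closedBall x r) ≤ volume (closedBall x r ∩ K) ∧
      σ * volume (closedBall x r) ≤ volume (closedBall x r ∩ L) := by
  obtain ⟨δ, hδ, hdisj⟩ := hKL.exists_cthickenings hK hL.isClosed
  have h' := h.and (Ioc_mem_nhdsGT (half_pos hδ))
  obtain ⟨ε, hε, hεP⟩ := exists_seq_forall_of_frequently h'.frequently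
  choose hP hεI using hεP
  choose X ρ hρ hsub hXK hXL using hP
  have hne : ∀ (n : ℕ) (S : Set (Fin d → ℝ)),
      σ * volume (closedBall (X n) (ρ n)) ≤ volume (closedBall (X n) (ρ n) ∩ S) →
      (closedBall (X n) (ρ n) ∩ S).Nonempty := by
    intro n S hS
    refine nonempty_of_measure_ne_zero (μ := volume) (ne_of_gt (lt_of_lt_of_le ?_ hS))
    exact ENNReal.mul_pos hσ₀ (measure_closedBall_pos _ _ (hρ n)).ne'
  have hmem : ∀ n, (X n, ρ n) ∈ C ×ˢ Icc (δ / 4) (diam C) := fun n =>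
    ⟨hsub n (mem_closedBall_self (hρ n).le),
      div_four_le_radius_of_inter_cthickening (hεI n).1.le (hεI n).2 (hρ n) hdisj
        (hne n _ (hXK n)) (hne n _ (hXL n)),
      radius_le_diam_of_closedBall_subset hd hC.isBounded (hρ n) (hsub n)⟩
  obtain ⟨⟨x, r⟩, ⟨-, hr, -⟩, φ, hφ, hlim⟩ := (hC.prod isCompact_Icc).tendsto_subseq hmem
  have hr₀ : 0 < r := lt_of_lt_of_le (by positivity) hr
  have hX : Tendsto (fun n => X (φ n)) atTop (𝓝 x) := hlim.fst_nhds
  have hR : Tendsto (fun n => ρ (φ n)) atTop (𝓝 r) := hlim.snd_nhds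
  have hE : Tendsto (fun n => ε (φ n)) atTop (𝓝 0) :=
    (hε.mono_right nhdsWithin_le_nhds).comp hφ.tendsto_atTop
  exact ⟨x, r, hr₀,
    closedBall_subset_of_tendsto hC.isClosed (fun n => hρ (φ n)) hr₀ hX hR fun n => hsub (φ n),
    const_mul_volume_closedBall_le_of_tendsto hK.isClosed hσ (fun n => hρ (φ n)) hr₀ hX hR hE
      fun n => hXK (φ n),
    const_mul_volume_closedBall_le_of_tendsto hL.isClosed hσ (fun n => hρ (φ n)) hr₀ hX hR hE
      fun n => hXL (φ n)⟩

theorem IsDyadicSubcube.nonempty {d : ℕ} {Q : Set (Fin d → ℝ)} (h : IsDyadicSubcube Q) :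
    Q.Nonempty := by
  obtain ⟨k, n, -, rfl⟩ := h
  refine ⟨fun j => (n j : ℝ) / 2 ^ k, fun j _ => ⟨?_, le_rfl⟩⟩
  exact div_le_div_of_nonneg_right (sub_le_self _ zero_le_one) (by positivity)

theorem IsDyadicSubcube.isClosed {d : ℕ} {Q : Set (Fin d → ℝ)} (h : IsDyadicSubcube Q) :
    IsClosed Q := by
  obtain ⟨k, n, -, rfl⟩ := h
  exact isClosed_set_pi fun _ _ => isClosed_Icc

theorem IsDyadicSubcube.subset_unitCube {d : ℕ} {Q : Set (Fin d → ℝ)} (h : IsDyadicSubcube Q) :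
    Q ⊆ Set.univ.pi fun _ => Icc (0 : ℝ) 1 := by
  obtain ⟨k, n, hn, rfl⟩ := h
  refine pi_mono fun j _ => Icc_subset_Icc ?_ ?_
  · have : (1 : ℝ) ≤ n j := by exact_mod_cast (hn j).1
    exact div_nonneg (by linarith) (by positivity)
  · rw [div_le_one (by positivity)]
    exact_mod_cast (hn j).2

theorem IsMultiCube.nonempty {d : ℕ} {F : Set (Fin d → ℝ)} (h : IsMultiCube F) : F.Nonempty := by
  obtain ⟨C, -, ⟨Q, hQ⟩, hC, rfl⟩ := h
  exact (hC Q hQ).nonempty.mono (subset_sUnion_of_mem hQ)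

theorem IsMultiCube.isClosed {d : ℕ} {F : Set (Fin d → ℝ)} (h : IsMultiCube F) : IsClosed F := by
  obtain ⟨C, hfin, -, hC, rfl⟩ := h
  rw [sUnion_eq_biUnion]
  exact hfin.isClosed_biUnion fun Q hQ => (hC Q hQ).isClosed

theorem IsMultiCube.subset_unitCube {d : ℕ} {F : Set (Fin d → ℝ)} (h : IsMultiCube F) :
    F ⊆ Set.univ.pi fun _ => Icc (0 : ℝ) 1 := by
  obtain ⟨C, -, -, hC, rfl⟩ := h
  exact sUnion_subset fun Q hQ => (hC Q hQ).subset_unitCube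

theorem exists_dyadic_index {t : ℝ} (ht : t ∈ Icc (0 : ℝ) 1) (k : ℕ) :
    ∃ n : ℕ, (1 ≤ n ∧ n ≤ 2 ^ k) ∧ t ∈ Icc (((n : ℝ) - 1) / 2 ^ k) ((n : ℝ) / 2 ^ k) := by
  have hk : (0 : ℝ) < 2 ^ k := by positivity
  refine ⟨max 1 ⌈t * 2 ^ k⌉₊, ⟨le_max_left _ _, max_le Nat.one_le_two_pow ?_⟩, ?_, ?_⟩
  · rw [Nat.ceil_le]
    push_cast
    nlinarith [ht.2]
  · rw [div_le_iff₀ hk, Nat.cast_max, sub_le_iff_le_add, max_le_iff]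
    have h0 : 0 ≤ t * 2 ^ k := mul_nonneg ht.1 hk.le
    exact ⟨by simpa using h0, (Nat.ceil_lt_add_one h0).le⟩
  · rw [le_div_iff₀ hk]
    exact (Nat.le_ceil _).trans (by exact_mod_cast le_max_right _ _)

theorem exists_isMultiCube_between {d : ℕ} {K : Set (Fin d → ℝ)} (hne : K.Nonempty)
    (hK : K ⊆ Set.univ.pi fun _ => Icc (0 : ℝ) 1) {ε : ℝ} (hε : 0 < ε) :
    ∃ F, IsMultiCube F ∧ K ⊆ F ∧ F ⊆ cthickening ε K := by
  obtain ⟨k, hk⟩ := exists_pow_lt_of_lt_one hε (show (1 / 2 : ℝ) < 1 by norm_num)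
  let cube : (Fin d → ℕ) → Set (Fin d → ℝ) := fun n =>
    Set.univ.pi fun j => Icc (((n j : ℝ) - 1) / 2 ^ k) ((n j : ℝ) / 2 ^ k)
  let N : Set (Fin d → ℕ) := {n | (∀ j, 1 ≤ n j ∧ n j ≤ 2 ^ k) ∧ (cube n ∩ K).Nonempty}
  have hcover : ∀ x ∈ K, ∃ n ∈ N, x ∈ cube n := by
    intro x hx
    choose n hn hxn using fun j => exists_dyadic_index (hK hx j (mem_univ j)) k
    have hxc : x ∈ cube n := fun j _ => hxn j
    exact ⟨n, ⟨hn, x, hxc, hx⟩, hxc⟩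
  refine ⟨⋃₀ (cube '' N), ⟨cube '' N, ?_, ?_, ?_, rfl⟩, ?_, ?_⟩
  · refine Finite.image _ ((finite_Icc (fun _ => 1) (fun _ => 2 ^ k)).subset ?_)
    exact fun n hn => ⟨fun j => (hn.1 j).1, fun j => (hn.1 j).2⟩
  · obtain ⟨x, hx⟩ := hne
    obtain ⟨n, hn, -⟩ := hcover x hx
    exact ⟨_, mem_image_of_mem _ hn⟩
  · rintro _ ⟨n, hn, rfl⟩
    exact ⟨k, n, hn.1, rfl⟩
  · intro x hx
    obtain ⟨n, hn, hxn⟩ := hcover x hx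
    exact ⟨_, mem_image_of_mem _ hn, hxn⟩
  · rintro y ⟨_, ⟨n, ⟨-, z, hz, hzK⟩, rfl⟩, hy⟩
    refine mem_cthickening_of_dist_le y z _ _ hzK ((dist_pi_le_iff hε.le).2 fun j => ?_)
    refine (Real.dist_le_of_mem_Icc (hy j (mem_univ j)) (hz j (mem_univ j))).trans ?_
    have : (n j : ℝ) / 2 ^ k - ((n j : ℝ) - 1) / 2 ^ k = (1 / 2) ^ k := by
      rw [div_pow, one_pow]
      ring
    exact this.trans_le hk.le

theorem exists_isCompact_subset_of_mul_volume_lt {α : Type*} [TopologicalSpace α] [T2Space α]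
    [MeasurableSpace α] [OpensMeasurableSpace α] {μ : Measure α} [μ.InnerRegularCompactLTTop]
    {Q A B : Set α} (hA : MeasurableSet A) (hB : MeasurableSet B) (hAQ : μ A ≠ ∞) (hBQ : μ B ≠ ∞)
    {τ : ℝ≥0∞} (hτ : τ ≠ ∞) (h : τ * μ ((Q \ A) \ B) < min (μ A) (μ B)) :
    ∃ K L, K ⊆ A ∧ L ⊆ B ∧ IsCompact K ∧ IsCompact L ∧ μ K ≠ 0 ∧ μ L ≠ 0 ∧
      τ * μ ((Q \ K) \ L) ≤ min (μ K) (μ L) := by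
  set m := min (μ A) (μ B)
  set R := μ ((Q \ A) \ B)
  have hm : m ≠ ∞ := ((min_le_left _ _).trans_lt hAQ.lt_top).ne
  have hc : 2 * τ + 1 ≠ ∞ := by finiteness
  have hc₀ : 2 * τ + 1 ≠ 0 := by simp
  obtain ⟨ε, hε₀, hε⟩ : ∃ ε : ℝ≥0∞, ε ≠ 0 ∧ (2 * τ + 1) * ε = m - τ * R :=
    ⟨(m - τ * R) / (2 * τ + 1), (ENNReal.div_pos (tsub_pos_of_lt h).ne' hc).ne',
      ENNReal.mul_div_cancel hc₀ hc⟩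
  have hεm : ε ≤ m := calc
    ε ≤ (2 * τ + 1) * ε := le_mul_of_one_le_left zero_le (by simp)
    _ ≤ m := hε.trans_le tsub_le_self
  have hεtop : ε ≠ ∞ := (hεm.trans_lt hm.lt_top).ne
  have hsum : τ * (R + 2 * ε) + ε = m := by
    rw [← add_tsub_cancel_of_le h.le, ← hε]
    ring
  obtain ⟨K, hKA, hK, hKε⟩ := hA.exists_isCompact_sdiff_lt hAQ hε₀
  obtain ⟨L, hLB, hL, hLε⟩ := hB.exists_isCompact_sdiff_lt hBQ hε₀
  have hdiff : μ ((Q \ K) \ L) ≤ R + 2 * ε := by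
    have hsub : (Q \ K) \ L ⊆ ((Q \ A) \ B) ∪ ((A \ K) ∪ (B \ L)) := by
      intro x hx
      by_cases hxA : x ∈ A <;> by_cases hxB : x ∈ B <;> simp_all
    calc μ ((Q \ K) \ L) ≤ R + (μ (A \ K) + μ (B \ L)) :=
          (measure_mono hsub).trans ((measure_union_le _ _).trans
            (add_le_add_right (measure_union_le _ _) _))
      _ ≤ R + 2 * ε := by rw [two_mul]; gcongr
  have key : ∀ {S T : Set α}, m ≤ μ S → μ (S \ T) < ε →
      μ T ≠ 0 ∧ τ * μ ((Q \ K) \ L) ≤ μ T := by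
    intro S T hS hST
    have hle : μ S ≤ μ T + μ (S \ T) := by
      refine (measure_mono ?_).trans (measure_union_le T (S \ T))
      rw [union_sdiff_self]
      exact subset_union_right
    constructor
    · intro h0
      rw [h0, zero_add] at hle
      exact absurd (hεm.trans (hS.trans hle)) hST.not_ge
    · refine le_trans (by gcongr) (ENNReal.le_of_add_le_add_right hεtop
        (show τ * (R + 2 * ε) + ε ≤ μ T + ε from ?_))
      rw [hsum]
      exact hS.trans (hle.trans (by gcongr))
  have h₁ := key (min_le_left _ _) hKε
  have h₂ := key (min_le_right _ _) hLε
  exact ⟨K, L, hKA, hLB, hK, hL, h₁.1, h₂.1, le_min h₁.2 h₂.2⟩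

theorem exists_cube_of_multiCube_condition {d : ℕ} (hd : 1 ≤ d) {τ s : ℝ} (hs : 0 < s)
    (h : ∀ Fp Fm : Set (Fin d → ℝ), IsMultiCube Fp → IsMultiCube Fm → Disjoint Fp Fm →
      min (volume Fp) (volume Fm) ≥
        ENNReal.ofReal τ * volume (((Set.univ.pi fun _ : Fin d => Icc (0:ℝ) 1) \ Fp) \ Fm) →
      ∃ W : Set (Fin d → ℝ), IsCube W ∧ W ⊆ (Set.univ.pi fun _ : Fin d => Icc (0:ℝ) 1) ∧
        min (volume (W ∩ Fp)) (volume (W ∩ Fm)) ≥ ENNReal.ofReal s * volume W)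
    {A B : Set (Fin d → ℝ)} (hA : MeasurableSet A) (hB : MeasurableSet B)
    (hAQ : A ⊆ Set.univ.pi fun _ : Fin d => Icc (0:ℝ) 1)
    (hBQ : B ⊆ Set.univ.pi fun _ : Fin d => Icc (0:ℝ) 1) (hAB : Disjoint A B)
    (hlt : ENNReal.ofReal τ * volume (((Set.univ.pi fun _ : Fin d => Icc (0:ℝ) 1) \ A) \ B) <
      min (volume A) (volume B)) :
    ∃ W : Set (Fin d → ℝ), IsCube W ∧ W ⊆ (Set.univ.pi fun _ : Fin d => Icc (0:ℝ) 1) ∧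
      ENNReal.ofReal s * volume W ≤ min (volume (A ∩ W)) (volume (B ∩ W)) := by
  have hC : IsCompact (Set.univ.pi fun _ : Fin d => Icc (0:ℝ) 1) :=
    isCompact_univ_pi fun _ => isCompact_Icc
  obtain ⟨K, L, hKA, hLB, hK, hL, hK₀, hL₀, hKL⟩ := exists_isCompact_subset_of_mul_volume_lt hA hB
    ((measure_mono hAQ).trans_lt hC.measure_lt_top).ne
    ((measure_mono hBQ).trans_lt hC.measure_lt_top).ne ENNReal.ofReal_ne_top hlt
  have hdisj : Disjoint K L := hAB.mono hKA hLB
  obtain ⟨δ, hδ, hδdisj⟩ := hdisj.exists_cthickenings hK hL.isClosed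
  obtain ⟨x, r, hr, hsub, h₁, h₂⟩ := exists_closedBall_of_cthickening hd hC hK hL hdisj
    (σ := ENNReal.ofReal s) (by simpa using hs) ENNReal.ofReal_ne_top (by
      filter_upwards [Ioc_mem_nhdsGT hδ] with ε hε
      obtain ⟨F, hF, hKF, hFK⟩ := exists_isMultiCube_between
        (nonempty_of_measure_ne_zero hK₀) (hKA.trans hAQ) hε.1
      obtain ⟨G, hG, hLG, hGL⟩ := exists_isMultiCube_between
        (nonempty_of_measure_ne_zero hL₀) (hLB.trans hBQ) hε.1
      obtain ⟨W, hW, hWQ, hWs⟩ := h F G hF hG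
        (hδdisj.mono (hFK.trans (cthickening_mono hε.2 _)) (hGL.trans (cthickening_mono hε.2 _)))
        (calc _ ≤ ENNReal.ofReal τ *
              volume (((Set.univ.pi fun _ : Fin d => Icc (0:ℝ) 1) \ K) \ L) := by gcongr
          _ ≤ _ := hKL.trans (min_le_min (measure_mono hKF) (measure_mono hLG)))
      obtain ⟨x, r, hr, rfl⟩ := isCube_iff_closedBall.1 hW
      exact ⟨x, r, hr, hWQ, (le_min_iff.1 hWs).1.trans (by gcongr),
        (le_min_iff.1 hWs).2.trans (by gcongr)⟩)
  refine ⟨closedBall x r, isCube_iff_closedBall.2 ⟨x, r, hr, rfl⟩, hsub, le_min ?_ ?_⟩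
  · exact h₁.trans (measure_mono fun y hy => ⟨hKA hy.2, hy.1⟩)
  · exact h₂.trans (measure_mono fun y hy => ⟨hLB hy.2, hy.1⟩)

theorem volume_preimage_add_smul {d : ℕ} (a : Fin d → ℝ) {l : ℝ} (hl : l ≠ 0)
    (S : Set (Fin d → ℝ)) :
    volume ((fun x => a + l • x) ⁻¹' S) = ENNReal.ofReal |(l ^ d)⁻¹| * volume S := by
  rw [show (fun x => a + l • x) ⁻¹' S = (fun x => l • x) ⁻¹' ((fun x => a + x) ⁻¹' S) from rfl,
    Measure.addHaar_preimage_smul volume hl, measure_preimage_add, Module.finrank_fin_fun]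

theorem preimage_add_smul_pi_Icc {d : ℕ} (a b : Fin d → ℝ) {l : ℝ} (hl : 0 < l) (m : ℝ) :
    (fun x => a + l • x) ⁻¹' (Set.univ.pi fun j => Icc ((a + l • b) j) ((a + l • b) j + l * m)) =
      Set.univ.pi fun j => Icc (b j) (b j + m) := by
  ext x
  simp only [mem_preimage, mem_univ_pi, mem_Icc, Pi.add_apply, Pi.smul_apply, smul_eq_mul,
    add_assoc, add_le_add_iff_left, ← mul_add, mul_le_mul_iff_right₀ hl]

theorem exists_pos_volume_cthickening_diff {d : ℕ} {F G : Set (Fin d → ℝ)}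
    {C : Set (Fin d → ℝ)} (hC : IsPreconnected C) (hreg : C ⊆ closure (interior C))
    (hF : IsClosed F) (hG : IsClosed G) (hFC : F ⊆ C) (hFne : F.Nonempty)
    (hGC : (C ∩ G).Nonempty) (hFG : Disjoint F G) {ε : ℝ} (hε : 0 < ε) :
    0 < volume (((C ∩ cthickening ε F) \ F) \ G) := by
  have hopen : IsOpen (thickening ε F ∩ Fᶜ ∩ Gᶜ) :=
    (isOpen_thickening.inter hF.isOpen_compl).inter hG.isOpen_compl
  have hne : (C ∩ (thickening ε F ∩ Fᶜ ∩ Gᶜ)).Nonempty := by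
    have hFG' : F ⊆ thickening ε F ∩ Gᶜ := subset_inter (self_subset_thickening hε F)
      (subset_compl_iff_disjoint_right.2 hFG)
    obtain ⟨y, hyC, hyU, hyF⟩ := hC (thickening ε F ∩ Gᶜ) Fᶜ
      (isOpen_thickening.inter hG.isOpen_compl) hF.isOpen_compl
      (fun x _ => (em (x ∈ F)).imp (fun h => hFG' h) id)
      (hFne.mono (subset_inter hFC hFG'))
      (hGC.mono (inter_subset_inter_right _ (subset_compl_iff_disjoint_left.2 hFG)))
    exact ⟨y, hyC, ⟨hyU.1, hyF⟩, hyU.2⟩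
  obtain ⟨y, hyC, hyV⟩ := hne
  have hint := mem_closure_iff.1 (hreg hyC) _ hopen hyV
  refine ((hopen.inter isOpen_interior).measure_pos volume hint).trans_le (measure_mono ?_)
  rintro z ⟨⟨⟨hz₁, hz₂⟩, hz₃⟩, hz₄⟩
  exact ⟨⟨⟨interior_subset hz₄, thickening_subset_cthickening _ _ hz₁⟩, hz₂⟩, hz₃⟩

theorem volume_diff_cthickening_lt {d : ℕ} {F G : Set (Fin d → ℝ)}
    {C : Set (Fin d → ℝ)} (hCc : IsCompact C) (hC : IsPreconnected C)
    (hreg : C ⊆ closure (interior C))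
    (hF : IsClosed F) (hG : IsClosed G) (hFC : F ⊆ C) (hFne : F.Nonempty)
    (hGC : (C ∩ G).Nonempty) (hFG : Disjoint F G) {ε : ℝ} (hε : 0 < ε) :
    volume ((C \ (C ∩ cthickening ε F)) \ (C ∩ cthickening ε G)) < volume ((C \ F) \ G) := by
  have hpos := exists_pos_volume_cthickening_diff hC hreg hF hG hFC hFne hGC hFG hε
  have hS : MeasurableSet (((C ∩ cthickening ε F) \ F) \ G) :=
    ((hCc.measurableSet.inter isClosed_cthickening.measurableSet).diff hF.measurableSet).diff
      hG.measurableSet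
  have hfin : volume ((C \ F) \ G) ≠ ∞ :=
    ((measure_mono (sdiff_subset.trans sdiff_subset)).trans_lt hCc.measure_lt_top).ne
  have hsubS : ((C ∩ cthickening ε F) \ F) \ G ⊆ (C \ F) \ G := by
    gcongr
    exact inter_subset_left
  calc volume ((C \ (C ∩ cthickening ε F)) \ (C ∩ cthickening ε G))
      ≤ volume (((C \ F) \ G) \ (((C ∩ cthickening ε F) \ F) \ G)) := by
        refine measure_mono ?_
        rintro x ⟨⟨hx, hxF⟩, hxG⟩
        exact ⟨⟨⟨hx, fun h => hxF ⟨hx, self_subset_cthickening F h⟩⟩,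
          fun h => hxG ⟨hx, self_subset_cthickening G h⟩⟩, fun h => hxF h.1.1⟩
    _ = volume ((C \ F) \ G) - volume (((C ∩ cthickening ε F) \ F) \ G) :=
        measure_sdiff hsubS hS.nullMeasurableSet
          ((measure_mono hsubS).trans_lt hfin.lt_top).ne
    _ < volume ((C \ F) \ G) :=
        ENNReal.sub_lt_self hfin (hpos.trans_le (measure_mono hsubS)).ne' hpos.ne'

theorem stmt_19 (d : ℕ) (hd : 1 ≤ d) (τ s : ℝ) (hτ : 0 < τ) (hs : 0 < s) :
    IsJSPair d τ s ↔
      ∀ Fp Fm : Set (Fin d → ℝ), IsMultiCube Fp → IsMultiCube Fm → Disjoint Fp Fm →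
        min (volume Fp) (volume Fm) ≥
          ENNReal.ofReal τ *
            volume (((Set.univ.pi fun _ : Fin d => Set.Icc (0:ℝ) 1) \ Fp) \ Fm) →
        ∃ W : Set (Fin d → ℝ), IsCube W ∧
          W ⊆ (Set.univ.pi fun _ : Fin d => Set.Icc (0:ℝ) 1) ∧
          min (volume (W ∩ Fp)) (volume (W ∩ Fm)) ≥ ENNReal.ofReal s * volume W := by
  constructor
  · rintro ⟨-, -, h⟩ F G hF hG hFG hmin
    set C : Set (Fin d → ℝ) := Set.univ.pi fun _ => Icc (0:ℝ) 1
    have hCball : C = closedBall (fun _ => 1 / 2) (1 / 2) := unitCube_eq_closedBall d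
    have hC : IsCompact C := isCompact_univ_pi fun _ => isCompact_Icc
    have hFc : IsCompact F := hC.of_isClosed_subset hF.isClosed hF.subset_unitCube
    have hGc : IsCompact G := hC.of_isClosed_subset hG.isClosed hG.subset_unitCube
    have hconn : IsPreconnected C :=
      isPreconnected_univ_pi fun _ => isPreconnected_Icc
    have hreg : C ⊆ closure (interior C) := by
      rw [hCball, interior_closedBall _ (by norm_num), closure_ball _ (by norm_num)]
    obtain ⟨δ, hδ, hδdisj⟩ := hFG.exists_cthickenings hFc hG.isClosed
    obtain ⟨x, r, hr, hsub, h₁, h₂⟩ := exists_closedBall_of_cthickening hd hC hFc hGc hFG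
      (σ := ENNReal.ofReal s) (by simpa using hs) ENNReal.ofReal_ne_top (by
        filter_upwards [Ioc_mem_nhdsGT hδ] with ε hε
        have hlt := volume_diff_cthickening_lt hC hconn hreg hF.isClosed hG.isClosed
          hF.subset_unitCube hF.nonempty
          (hG.nonempty.mono (subset_inter hG.subset_unitCube subset_rfl)) hFG hε.1
        obtain ⟨W, hW, hWC, hWs⟩ := h C
          (isCube_iff_closedBall.2 ⟨_, _, by norm_num, hCball⟩)
          (C ∩ cthickening ε F) (C ∩ cthickening ε G)
          (hC.measurableSet.inter isClosed_cthickening.measurableSet)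
          (hC.measurableSet.inter isClosed_cthickening.measurableSet)
          inter_subset_left inter_subset_left
          (hδdisj.mono (inter_subset_right.trans (cthickening_mono hε.2 _))
            (inter_subset_right.trans (cthickening_mono hε.2 _)))
          (calc _ < ENNReal.ofReal τ * volume ((C \ F) \ G) :=
                ENNReal.mul_lt_mul_right (by simpa using hτ) ENNReal.ofReal_ne_top hlt
            _ ≤ _ := hmin.le.trans (min_le_min
                (measure_mono (subset_inter hF.subset_unitCube (self_subset_cthickening F)))
                (measure_mono (subset_inter hG.subset_unitCube (self_subset_cthickening G)))))
        obtain ⟨x, r, hr, rfl⟩ := isCube_iff_closedBall.1 hW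
        exact ⟨x, r, hr, hWC,
          (le_min_iff.1 hWs).1.trans (measure_mono fun y hy => ⟨hy.2, hy.1.2⟩),
          (le_min_iff.1 hWs).2.trans (measure_mono fun y hy => ⟨hy.2, hy.1.2⟩)⟩)
    exact ⟨closedBall x r, isCube_iff_closedBall.2 ⟨x, r, hr, rfl⟩, hsub, le_min h₁ h₂⟩
  · intro h
    refine ⟨hτ, hs, ?_⟩
    rintro _ ⟨a, l, hl, rfl⟩ A B hA hB hAQ hBQ hAB hlt
    set φ : (Fin d → ℝ) → Fin d → ℝ := fun x => a + l • x
    set c := ENNReal.ofReal |(l ^ d)⁻¹|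
    have hφ : Measurable φ := by fun_prop
    have hc₀ : c ≠ 0 := by
      have : 0 < |(l ^ d)⁻¹| := by positivity
      simpa [c] using this
    have hc : c ≠ ∞ := ENNReal.ofReal_ne_top
    have hvol : ∀ S, volume (φ ⁻¹' S) = c * volume S := volume_preimage_add_smul a hl.ne'
    have hQ : φ ⁻¹' (Set.univ.pi fun j => Icc (a j) (a j + l)) =
        Set.univ.pi fun _ => Icc (0:ℝ) 1 := by
      simpa using preimage_add_smul_pi_Icc a 0 hl 1
    obtain ⟨_, ⟨b, m, hm, rfl⟩, hWQ, hWs⟩ := exists_cube_of_multiCube_condition (τ := τ) hd hs h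
      (hφ hA) (hφ hB) (hQ ▸ preimage_mono hAQ) (hQ ▸ preimage_mono hBQ) (hAB.preimage φ) (by
        rw [← hQ, ← preimage_sdiff, ← preimage_sdiff, hvol, hvol, hvol, mul_left_comm, ← mul_min]
        exact ENNReal.mul_lt_mul_right hc₀ hc hlt)
    have hsurj : Function.Surjective φ := fun y =>
      ⟨l⁻¹ • (y - a), by simp [φ, smul_smul, mul_inv_cancel₀ hl.ne']⟩
    refine ⟨_, ⟨a + l • b, l * m, mul_pos hl hm, rfl⟩, ?_, ?_⟩
    · rw [← hsurj.preimage_subset_preimage_iff, hQ, preimage_add_smul_pi_Icc a b hl]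
      exact hWQ
    · rw [← preimage_add_smul_pi_Icc a b hl, ← preimage_inter, ← preimage_inter, hvol, hvol, hvol,
        mul_left_comm, ← mul_min] at hWs
      exact (ENNReal.mul_le_mul_iff_right hc₀ hc).1 hWs
end
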